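/- Let θ ∈ (0,1) and let a, b > 0 be real exponents with a ≤ θ and a + b > 1. Suppose X, Y, Z, X̃, Ỹ, Z̃ are real numbers in [0,1] satisfying: Z > 0, θX + (1−θ)Y ≤ Z, Z ≤ X^a Y^b, θX̃ + (1−θ)Ỹ ≤ Z̃, Z̃ ≤ X̃^a Ỹ^b, Y + Ỹ = 1, and Z + Z̃ = 1. Then Z = 1 (and consequently Z̃ = 0). -/

import Mathlib

theorem pos_of_pos_of_le_rpow_mul_rpow {a b x y z : ℝ} (ha : a ≠ 0) (hb : b ≠ 0)
    (hx : 0 ≤ x) (hy : 0 ≤ y) (hz : 0 < z) (h : z ≤ x ^ a * y ^ b) : 0 < x ∧ 0 < y := by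
  refine ⟨hx.lt_of_ne' ?_, hy.lt_of_ne' ?_⟩ <;> rintro rfl
  · rw [Real.zero_rpow ha] at h
    linarith
  · rw [Real.zero_rpow hb] at h
    linarith

/-- A number lying between the `θ`-weighted arithmetic mean of `x, y` and `x ^ a * y ^ b`
is smaller than `y`, when `a ≤ θ`, `1 < a + b` and `y < 1`. -/
theorem lt_of_weighted_mean_le_of_le_rpow_mul_rpow {θ a b x y z : ℝ}
    (ha : 0 < a) (ha1 : a ≤ 1) (haθ : a ≤ θ) (hab : 1 < a + b)
    (hx : 0 < x) (hy : 0 < y) (hy1 : y < 1)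
    (hmean : θ * x + (1 - θ) * y ≤ z) (hz : z ≤ x ^ a * y ^ b) : z < y := by
  have hpow : y ^ b < y ^ (1 - a) := Real.rpow_lt_rpow_of_exponent_gt hy hy1 (by linarith)
  have hlt : x ^ a * y ^ b < x ^ a * y ^ (1 - a) :=
    mul_lt_mul_of_pos_left hpow (Real.rpow_pos_of_pos hx a)
  have hamgm : x ^ a * y ^ (1 - a) ≤ a * x + (1 - a) * y :=
    Real.geom_mean_le_arith_mean2_weighted ha.le (by linarith) hx.le hy.le (by ring)
  have hxy : x < y := by
    by_contra! hle
    nlinarith [mul_nonneg (sub_nonneg.2 haθ) (sub_nonneg.2 hle)]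
  nlinarith [mul_pos ha (sub_pos.2 hxy)]

/-- Let `θ ∈ (0,1)` and let `a, b > 0` with `a ≤ θ` and `a + b > 1`.  If
`X, Y, Z, X̃, Ỹ, Z̃ ∈ [0,1]` satisfy `Z > 0`, `θX + (1-θ)Y ≤ Z`, `Z ≤ X^a Y^b`,
`θX̃ + (1-θ)Ỹ ≤ Z̃`, `Z̃ ≤ X̃^a Ỹ^b`, `Y + Ỹ = 1` and `Z + Z̃ = 1`, then `Z = 1`
(and consequently `Z̃ = 0`).  Here `x ^ a` is the real power (with `0 ^ a = 0` for
`a > 0`). -/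
theorem concentration_dichotomy
    (θ a b X Y Z X' Y' Z' : ℝ)
    (hθ0 : 0 < θ) (hθ1 : θ < 1)
    (ha : 0 < a) (hb : 0 < b) (haθ : a ≤ θ) (hab : 1 < a + b)
    (hX : X ∈ Set.Icc (0 : ℝ) 1) (hY : Y ∈ Set.Icc (0 : ℝ) 1)
    (hZ : Z ∈ Set.Icc (0 : ℝ) 1)
    (hX' : X' ∈ Set.Icc (0 : ℝ) 1) (hY' : Y' ∈ Set.Icc (0 : ℝ) 1)
    (hZ' : Z' ∈ Set.Icc (0 : ℝ) 1)
    (hZpos : 0 < Z)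
    (h1 : θ * X + (1 - θ) * Y ≤ Z)
    (h2 : Z ≤ X ^ a * Y ^ b)
    (h3 : θ * X' + (1 - θ) * Y' ≤ Z')
    (h4 : Z' ≤ X' ^ a * Y' ^ b)
    (hYsum : Y + Y' = 1)
    (hZsum : Z + Z' = 1) :
    Z = 1 ∧ Z' = 0 := by
  obtain hZ0 | hZ0 := hZ'.1.eq_or_lt
  · exact ⟨by linarith, hZ0.symm⟩
  · obtain ⟨hXpos, hYpos⟩ :=
      pos_of_pos_of_le_rpow_mul_rpow ha.ne' hb.ne' hX.1 hY.1 hZpos h2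
    obtain ⟨hXpos', hYpos'⟩ :=
      pos_of_pos_of_le_rpow_mul_rpow ha.ne' hb.ne' hX'.1 hY'.1 hZ0 h4
    have hlt : Z < Y := lt_of_weighted_mean_le_of_le_rpow_mul_rpow ha (by linarith) haθ hab
      hXpos hYpos (by linarith) h1 h2
    have hlt' : Z' < Y' := lt_of_weighted_mean_le_of_le_rpow_mul_rpow ha (by linarith) haθ hab
      hXpos' hYpos' (by linarith) h3 h4
    linarith
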